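/- Let δ > 0, let γ : (0, δ) → [0, π] be measurable, and let b ∈ (0, 1). Then b·cos(limsup_{t→0⁺} γ(t)) ≤ A_I(b) ≤ A_S(b) ≤ b·cos(liminf_{t→0⁺} γ(t)). -/

import Mathlib

open Real Set Filter MeasureTheory Topology

/-- `A_I(b) = liminf_{ε→0⁺} (1/ε) ∫₀^{bε} cos γ(t) dt`. -/
noncomputable def fanAI (γ : ℝ → ℝ) (b : ℝ) : ℝ :=
  liminf (fun ε : ℝ => ε⁻¹ * ∫ t in Ioo (0:ℝ) (b * ε), Real.cos (γ t)) (𝓝[>] (0:ℝ))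

/-- `A_S(b) = limsup_{ε→0⁺} (1/ε) ∫₀^{bε} cos γ(t) dt`. -/
noncomputable def fanAS (γ : ℝ → ℝ) (b : ℝ) : ℝ :=
  limsup (fun ε : ℝ => ε⁻¹ * ∫ t in Ioo (0:ℝ) (b * ε), Real.cos (γ t)) (𝓝[>] (0:ℝ))

theorem fan_aux (f : ℝ → ℝ) (hf : Measurable f) (h1 : ∀ t, |f t| ≤ 1) (b : ℝ)
    (hb : 0 < b) (m : ℝ) (hm : ∀ᶠ t in 𝓝[>] (0:ℝ), m ≤ f t) :
    ∀ᶠ ε in 𝓝[>] (0:ℝ), b * m ≤ ε⁻¹ * ∫ t in Ioo (0:ℝ) (b * ε), f t := by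
  obtain ⟨r, hr, hr'⟩ := mem_nhdsGT_iff_exists_Ioo_subset.1 hm
  have hr0 : (0:ℝ) < r := hr
  have hmem : Ioo (0:ℝ) (r / b) ∈ 𝓝[>] (0:ℝ) := Ioo_mem_nhdsGT (by positivity)
  filter_upwards [hmem] with ε hε
  have hε0 : 0 < ε := hε.1
  have hbe : b * ε < r := by
    have := (lt_div_iff₀ hb).1 hε.2
    linarith
  have hfin : volume (Ioo (0:ℝ) (b * ε)) ≠ ⊤ := by simp
  have hint : IntegrableOn f (Ioo (0:ℝ) (b * ε)) := by
    refine Measure.integrableOn_of_bounded (M := 1) hfin hf.aestronglyMeasurable ?_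
    exact Eventually.of_forall (fun t => by simpa using h1 t)
  have hle : ∫ t in Ioo (0:ℝ) (b * ε), m ≤ ∫ t in Ioo (0:ℝ) (b * ε), f t := by
    refine setIntegral_mono_on (integrableOn_const hfin) hint measurableSet_Ioo ?_
    intro t ht
    exact hr' ⟨ht.1, ht.2.trans hbe⟩
  have hc : ∫ t in Ioo (0:ℝ) (b * ε), m = b * ε * m := by
    rw [setIntegral_const]
    simp [Measure.real, (mul_pos hb hε0).le]
  rw [hc] at hle
  calc b * m = ε⁻¹ * (b * ε * m) := by field_simp
    _ ≤ _ := by gcongr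

theorem fan_aux' (f : ℝ → ℝ) (hf : Measurable f) (h1 : ∀ t, |f t| ≤ 1) (b : ℝ)
    (hb : 0 < b) (m : ℝ) (hm : ∀ᶠ t in 𝓝[>] (0:ℝ), f t ≤ m) :
    ∀ᶠ ε in 𝓝[>] (0:ℝ), ε⁻¹ * ∫ t in Ioo (0:ℝ) (b * ε), f t ≤ b * m := by
  have := fan_aux (fun t => - f t) hf.neg (by simpa using h1) b hb (-m)
    (by filter_upwards [hm] with t ht; linarith)
  filter_upwards [this] with ε h
  rw [integral_neg] at h
  linarith

/-- For measurable `γ : (0,δ) → [0,π]` and `b ∈ (0,1)`,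
`b·cos(limsup_{t→0⁺} γ(t)) ≤ A_I(b) ≤ A_S(b) ≤ b·cos(liminf_{t→0⁺} γ(t))`. -/
theorem fanAI_le_fanAS_bounds (δ : ℝ) (hδ : 0 < δ)
    (γ : ℝ → ℝ) (hmeas : Measurable γ)
    (hrange : ∀ t ∈ Ioo (0:ℝ) δ, γ t ∈ Icc 0 π)
    (b : ℝ) (hb : b ∈ Ioo (0:ℝ) 1) :
    b * Real.cos (limsup γ (𝓝[>] (0:ℝ))) ≤ fanAI γ b ∧
      fanAI γ b ≤ fanAS γ b ∧
      fanAS γ b ≤ b * Real.cos (liminf γ (𝓝[>] (0:ℝ))) := by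
  have hb0 := hb.1
  have hf : Measurable (fun t => Real.cos (γ t)) := Real.measurable_cos.comp hmeas
  have h1 : ∀ t, |Real.cos (γ t)| ≤ 1 := fun t => Real.abs_cos_le_one _
  have hev : ∀ᶠ t in 𝓝[>] (0:ℝ), γ t ∈ Icc 0 π := by
    filter_upwards [Ioo_mem_nhdsGT hδ] with t ht using hrange t ht
  have hev0 : ∀ᶠ t in 𝓝[>] (0:ℝ), 0 ≤ γ t := hev.mono fun t h => h.1
  have hevp : ∀ᶠ t in 𝓝[>] (0:ℝ), γ t ≤ π := hev.mono fun t h => h.2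
  have gB : IsBoundedUnder (· ≤ ·) (𝓝[>] (0:ℝ)) γ := isBoundedUnder_of_eventually_le hevp
  have gB' : IsBoundedUnder (· ≥ ·) (𝓝[>] (0:ℝ)) γ := isBoundedUnder_of_eventually_ge hev0
  have hup := fan_aux' _ hf h1 b hb0 1 (Eventually.of_forall fun t => Real.cos_le_one _)
  have hlo := fan_aux _ hf h1 b hb0 (-1) (Eventually.of_forall fun t => Real.neg_one_le_cos _)
  have FB := isBoundedUnder_of_eventually_le hup
  have FB' := isBoundedUnder_of_eventually_ge hlo
  have hLp : limsup γ (𝓝[>] (0:ℝ)) ≤ π := limsup_le_of_le gB'.isCoboundedUnder_le hevp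
  have hl0 : 0 ≤ liminf γ (𝓝[>] (0:ℝ)) := le_liminf_of_le gB.isCoboundedUnder_ge hev0
  refine ⟨?_, liminf_le_limsup FB FB', ?_⟩
  · refine le_of_forall_pos_sub_le fun η hη => ?_
    refine le_liminf_of_le FB.isCoboundedUnder_ge ?_
    have key := fan_aux _ hf h1 b hb0 (Real.cos (limsup γ (𝓝[>] (0:ℝ))) - η / b) ?_
    · filter_upwards [key] with ε h
      have : b * (Real.cos (limsup γ (𝓝[>] (0:ℝ))) - η / b)
          = b * Real.cos (limsup γ (𝓝[>] (0:ℝ))) - η := by field_simp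
      linarith
    · obtain ⟨r, hr, hc⟩ := Metric.continuousAt_iff.1
        (Real.continuous_cos.continuousAt (x := limsup γ (𝓝[>] (0:ℝ)))) (η / b) (by positivity)
      have hlt := eventually_lt_of_limsup_lt (lt_add_of_pos_right _ hr) gB
      filter_upwards [hlt, hev] with t ht hm
      rcases le_total (γ t) (limsup γ (𝓝[>] (0:ℝ))) with h | h
      · have := Real.cos_le_cos_of_nonneg_of_le_pi hm.1 hLp h
        have : 0 < η / b := by positivity
        linarith
      · have := hc (x := γ t) (by rw [Real.dist_eq, abs_lt]; constructor <;> linarith)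
        rw [Real.dist_eq, abs_lt] at this
        linarith [this.1]
  · refine le_of_forall_pos_le_add fun η hη => ?_
    refine limsup_le_of_le FB'.isCoboundedUnder_le ?_
    have key := fan_aux' _ hf h1 b hb0 (Real.cos (liminf γ (𝓝[>] (0:ℝ))) + η / b) ?_
    · filter_upwards [key] with ε h
      have : b * (Real.cos (liminf γ (𝓝[>] (0:ℝ))) + η / b)
          = b * Real.cos (liminf γ (𝓝[>] (0:ℝ))) + η := by field_simp
      linarith
    · obtain ⟨r, hr, hc⟩ := Metric.continuousAt_iff.1
        (Real.continuous_cos.continuousAt (x := liminf γ (𝓝[>] (0:ℝ)))) (η / b) (by positivity)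
      have hlt := eventually_lt_of_lt_liminf (sub_lt_self _ hr) gB'
      filter_upwards [hlt, hev] with t ht hm
      rcases le_total (liminf γ (𝓝[>] (0:ℝ))) (γ t) with h | h
      · have := Real.cos_le_cos_of_nonneg_of_le_pi hl0 hm.2 h
        have : 0 < η / b := by positivity
        linarith
      · have := hc (x := γ t) (by rw [Real.dist_eq, abs_lt]; constructor <;> linarith)
        rw [Real.dist_eq, abs_lt] at this
        linarith [this.2]
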